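/- In R = A[[h]], let Q := 1 - (h²/4)b₊² and for α ∈ ℚ define Q^{α} := Σ_{n≥0} binom(α,n)(-(h²/4)b₊²)ⁿ. Set E := Q^{-1/2}e, H := h̄, T := (1 + (h/2)b₊)(1 - (h/2)b₊)⁻¹ and T⁻¹ := (1 - (h/2)b₊)(1 + (h/2)b₊)⁻¹ (the inverses exist since 1 ± (h/2)b₊ have constant term 1), and F := Q^{1/2}f - (h²/4)·b₊·Q^{-3/2}e - (h²/4)·b₊·Q^{-1/2}e·h̄. Then: HE - EH = (1/2)(T+T⁻¹)E; EF + FE = -(1/4)(T+T⁻¹)H - (1/4)H(T+T⁻¹); HT^{±1} - T^{±1}H = T^{±2} - 1; 2hE² = T - T⁻¹; and T^{±1}F - FT^{±1} = ±(h/2)(T^{±2}+1)E. -/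

import Mathlib

noncomputable section

/-- The generalized binomial coefficient `α(α-1)⋯(α-n+1)/n!`. -/
def qbinom (α : ℚ) (n : ℕ) : ℚ :=
  (∏ i ∈ Finset.range n, (α - (i : ℚ))) / (n.factorial : ℚ)

/-- `Q^α := Σ_{n≥0} binom(α,n)(-(h²/4)·b₊²)ⁿ` in `A[[h]]`, where `Q = 1 - (h²/4)b₊²`. -/
def Qpow {A : Type*} [Ring A] [Algebra ℂ A] (b : A) (α : ℚ) : PowerSeries A :=
  PowerSeries.mk fun m =>
    if m % 2 = 0 then
      (((qbinom α (m / 2) : ℚ) : ℂ) * (-(1/4) : ℂ) ^ (m / 2)) • b ^ m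
    else 0

section Commutators

variable {S R : Type*} [CommRing S] [Ring R] (φ : S →+* R) {y : R}

/-- The commutator of `y` with `φ a` is `φ a'`. -/
def HasCommutator (y : R) (a a' : S) : Prop :=
  y * φ a = φ a * y + φ a'

variable {φ}

theorem HasCommutator.mul {a a' b b' : S} (ha : HasCommutator φ y a a')
    (hb : HasCommutator φ y b b') : HasCommutator φ y (a * b) (a' * b + a * b') := by
  unfold HasCommutator at *
  rw [map_mul, ← mul_assoc, ha, add_mul, mul_assoc, hb, map_add, map_mul, map_mul]
  noncomm_ring

theorem HasCommutator.add {a a' b b' : S} (ha : HasCommutator φ y a a')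
    (hb : HasCommutator φ y b b') : HasCommutator φ y (a + b) (a' + b') := by
  unfold HasCommutator at *
  rw [map_add, mul_add, ha, hb, map_add]
  noncomm_ring

theorem HasCommutator.neg {a a' : S} (ha : HasCommutator φ y a a') :
    HasCommutator φ y (-a) (-a') := by
  unfold HasCommutator at *
  rw [map_neg, mul_neg, ha, map_neg]
  noncomm_ring

theorem hasCommutator_one : HasCommutator φ y 1 0 := by
  simp [HasCommutator]

theorem HasCommutator.sub {a a' b b' : S} (ha : HasCommutator φ y a a')
    (hb : HasCommutator φ y b b') : HasCommutator φ y (a - b) (a' - b') := by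
  simpa only [sub_eq_add_neg] using ha.add hb.neg

theorem HasCommutator.of_eq {a a' b b' : S} (ha : HasCommutator φ y a a')
    (h : a = b) (h' : a' = b') : HasCommutator φ y b b' :=
  h ▸ h' ▸ ha

theorem HasCommutator.inv {a a' u : S} (ha : HasCommutator φ y a a') (hu : a * u = 1) :
    HasCommutator φ y u (-(a' * u ^ 2)) := by
  unfold HasCommutator at *
  have hua : φ u * φ a = 1 := by rw [← map_mul, mul_comm, hu, map_one]
  have hau : φ a * φ u = 1 := by rw [← map_mul, hu, map_one]
  have h : φ u * (y * φ a) * φ u = φ u * (φ a * y + φ a') * φ u := by rw [ha]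
  have h₁ : φ u * (y * φ a) * φ u = φ u * y := by
    rw [mul_assoc, mul_assoc, hau, mul_one]
  have h₂ : φ u * (φ a * y + φ a') * φ u = y * φ u + φ (a' * u ^ 2) := by
    rw [mul_add, add_mul, ← mul_assoc, hua, one_mul, ← map_mul, ← map_mul]
    congr 2
    ring
  rw [h₁, h₂] at h
  rw [h, map_neg]
  noncomm_ring

theorem HasCommutator.invSqrt [Algebra ℂ R] {a c P : S} (ha : HasCommutator φ y a (2 * c))
    (hP : P ^ 2 * a = 1) (hcomm : Commute (φ P) (y * φ P - φ P * y)) :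
    HasCommutator φ y P (-(c * P ^ 3)) := by
  have hi := ha.inv (u := P ^ 2) (by rw [mul_comm, hP])
  unfold HasCommutator at *
  have hi' : φ P * (y * φ P - φ P * y) = -φ (c * P ^ 4) := by
    have h₁ : (2 : ℂ) • (φ P * (y * φ P - φ P * y))
        = φ P * (y * φ P - φ P * y) + (y * φ P - φ P * y) * φ P := by
      rw [← hcomm.eq, two_smul]
    have h₂ : φ P * (y * φ P - φ P * y) + (y * φ P - φ P * y) * φ P
        = y * φ (P ^ 2) - φ (P ^ 2) * y := by
      rw [map_pow]; noncomm_ring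
    apply smul_right_injective R (two_ne_zero (α := ℂ))
    beta_reduce
    rw [h₁, h₂, hi, add_sub_cancel_left, two_smul, ← map_neg, ← map_add]
    congr 1
    ring
  have hPa : φ (P * a) * φ P = 1 := by
    rw [← map_mul, ← map_one φ, ← hP]; ring_nf
  rw [← sub_eq_iff_eq_add', ← one_mul (y * φ P - φ P * y), ← hPa, mul_assoc, hi', ← map_neg,
    ← map_mul]
  congr 1
  linear_combination (-(c * P ^ 3)) * hP

end Commutators

section BinomialSeries

open PowerSeries

variable {A : Type*} [Ring A]

theorem PowerSeries.commute_of_coeff {p q : A⟦X⟧}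
    (h : ∀ m n, Commute (coeff m p) (coeff n q)) : Commute p q := by
  ext n
  rw [coeff_mul, coeff_mul, ← Finset.Nat.sum_antidiagonal_swap]
  exact Finset.sum_congr rfl fun x _ ↦ h _ _

theorem Commute.pow_commutator {b y : A} (h : Commute b (b * y - y * b)) (n : ℕ) :
    Commute b (b ^ n * y - y * b ^ n) := by
  induction n with
  | zero => simp
  | succ n ih =>
    have : b ^ (n + 1) * y - y * b ^ (n + 1)
        = b ^ n * (b * y - y * b) + (b ^ n * y - y * b ^ n) * b := by
      rw [pow_succ]; noncomm_ring
    rw [this]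
    exact (((Commute.refl b).pow_right n).mul_right h).add_right (ih.mul_right (Commute.refl b))

variable [Algebra ℂ A]

theorem qbinom_eq_choose (α : ℚ) (n : ℕ) : qbinom α n = Ring.choose α n := by
  rw [qbinom, Ring.choose_eq_smul, ← Polynomial.eval₂_smulOneHom_eq_smeval, smul_eq_mul,
    div_eq_inv_mul, ← Polynomial.eval_map, descPochhammer_map, descPochhammer_eval_eq_prod_range]

/-- The substitution `t ↦ b h`, as a ring homomorphism `ℂ[[t]] → A[[h]]`. -/
def substMulX (b : A) : ℂ⟦X⟧ →+* A⟦X⟧ where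
  toFun p := mk fun m ↦ coeff m p • b ^ m
  map_one' := by
    ext m
    by_cases h : m = 0 <;> simp [coeff_one, h]
  map_mul' p q := by
    ext m
    simp only [coeff_mk, coeff_mul, Finset.sum_smul]
    refine Finset.sum_congr rfl fun x hx ↦ ?_
    rw [smul_mul_smul_comm, ← pow_add, Finset.HasAntidiagonal.mem_antidiagonal.mp hx]
  map_zero' := by ext; simp
  map_add' p q := by ext; simp [add_smul]

theorem coeff_substMulX (b : A) (p : ℂ⟦X⟧) (m : ℕ) :
    coeff m (substMulX b p) = coeff m p • b ^ m := by
  simp [substMulX]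

theorem Qpow_eq_substMulX (b : A) (α : ℚ) :
    Qpow b α = substMulX b
      (expand 2 two_ne_zero (rescale (-(1/4) : ℂ) (PowerSeries.binomialSeries ℂ α))) := by
  ext m
  rw [Qpow, coeff_mk, coeff_substMulX, coeff_expand]
  split_ifs with h₁ h₂ h₂
  · rw [coeff_rescale, binomialSeries_coeff, qbinom_eq_choose, Rat.smul_def, mul_one, mul_comm]
  · exact absurd (Nat.dvd_of_mod_eq_zero h₁) h₂
  · exact absurd (Nat.mod_eq_zero_of_dvd h₂) h₁
  · rw [zero_smul]

theorem Qpow_add (b : A) (α β : ℚ) : Qpow b (α + β) = Qpow b α * Qpow b β := by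
  simp only [Qpow_eq_substMulX, binomialSeries_add, map_mul]

theorem Qpow_zero (b : A) : Qpow b 0 = 1 := by
  simp only [Qpow_eq_substMulX, binomialSeries_zero, map_one]

theorem substMulX_X (b : A) : substMulX b X = X * C b := by
  ext m
  rw [coeff_substMulX, coeff_X, coeff_mul_C, coeff_X]
  split_ifs with h <;> simp [h]

theorem substMulX_smul (b : A) (c : ℂ) (p : ℂ⟦X⟧) :
    substMulX b (c • p) = c • substMulX b p := by
  ext m
  simp [coeff_substMulX, mul_smul]

theorem Qpow_one (b : A) : Qpow b 1 = 1 - ((1/2 : ℂ) • (X * C b)) ^ 2 := by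
  have h : PowerSeries.binomialSeries ℂ (1 : ℚ) = 1 + X := by
    simpa using binomialSeries_nat (R := ℚ) (A := ℂ) 1
  rw [Qpow_eq_substMulX, h, map_add, map_one, rescale_X, map_add, map_one, ← smul_eq_C_mul,
    expand_smul, expand_X, map_add, map_one, substMulX_smul, map_pow, substMulX_X, smul_pow,
    sub_eq_add_neg, ← neg_smul]
  norm_num

theorem commute_Qpow_C {b y : A} (h : Commute b y) (α : ℚ) :
    Commute (Qpow b α) (C y) := by
  refine commute_of_coeff fun m n ↦ ?_
  rw [Qpow, coeff_mk, coeff_C]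
  split_ifs
  · exact (h.pow_left m).smul_left _
  all_goals simp

theorem commute_Qpow_commutator {b y : A} (h : Commute b (b * y - y * b)) (α : ℚ) :
    Commute (Qpow b α) (C y * Qpow b α - Qpow b α * C y) := by
  refine commute_of_coeff fun m n ↦ ?_
  rw [map_sub, coeff_C_mul, coeff_mul_C, Qpow, coeff_mk, coeff_mk]
  by_cases hm : m % 2 = 0
  · by_cases hn : n % 2 = 0
    · rw [if_pos hm, if_pos hn, smul_mul_assoc, mul_smul_comm, ← smul_sub, ← neg_sub, smul_neg]
      exact ((((h.pow_commutator n).pow_left m).smul_left _).smul_right _).neg_right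
    · simp [hn]
  · simp [hm]

end BinomialSeries

/-- The Jordanian relations, expressed through a commutative ring `S` containing `e`,
`k = h/2`, `P = Q^{-1/2}`, `u = (1 - k e²)⁻¹` and `v = (1 + k e²)⁻¹`. -/
theorem jordanian_relations {S R : Type*} [CommRing S] [Ring R] [Algebra ℂ R]
    (φ : S →+* R) {k e P u v : S} {H f : R}
    (hkH : Commute (φ k) H) (hkf : Commute (φ k) f)
    (hu : (1 - k * e ^ 2) * u = 1) (hv : (1 + k * e ^ 2) * v = 1)
    (hP : P ^ 2 * (1 - (k * e ^ 2) ^ 2) = 1)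
    (hHe : H * φ e - φ e * H = φ e) (hef : φ e * f + f * φ e = -H)
    (hPH : Commute (φ P) (H * φ P - φ P * H)) (hPf : Commute (φ P) (f * φ P - φ P * f))
    {E F T Tinv : R} (hE : E = φ (P * e)) (hT : T = φ (2 * u - 1)) (hTinv : Tinv = φ (2 * v - 1))
    (hF : F = φ (P * (1 - (k * e ^ 2) ^ 2)) * f - φ (k ^ 2 * e ^ 3 * P ^ 3)
      - φ (k ^ 2 * e ^ 3 * P) * H) :
    2 * (H * E - E * H) = (T + Tinv) * E ∧
    4 * (E * F + F * E) = -((T + Tinv) * H) - H * (T + Tinv) ∧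
    H * T - T * H = T ^ 2 - 1 ∧
    H * Tinv - Tinv * H = Tinv ^ 2 - 1 ∧
    4 * (φ k * E ^ 2) = T - Tinv ∧
    T * F - F * T = φ k * ((T ^ 2 + 1) * E) ∧
    Tinv * F - F * Tinv = -(φ k * ((Tinv ^ 2 + 1) * E)) := by
  have he : HasCommutator φ H e e := by
    exact eq_add_of_sub_eq' hHe
  have hk : HasCommutator φ H k 0 := by
    rw [HasCommutator, hkH.eq, map_zero, add_zero]
  have hx : HasCommutator φ H (k * e ^ 2) (2 * (k * e ^ 2)) :=
    (hk.mul (he.mul he)).of_eq (by ring) (by ring)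
  have hfx : HasCommutator φ f (k * e ^ 2) (-(k * e)) := by
    have h : f * (φ e * φ e) = φ e * φ e * f - φ e := by
      have h₁ : f * φ e = -H - φ e * f := by rw [← hef]; abel
      have h₂ : H * φ e = φ e * H + φ e := he
      rw [← mul_assoc, h₁, sub_mul, mul_assoc, h₁, neg_mul, h₂]
      noncomm_ring
    rw [HasCommutator, map_mul, ← mul_assoc, ← hkf.eq, pow_two, map_mul, mul_assoc, h, map_neg,
      map_mul]
    noncomm_ring
  have hHu : HasCommutator φ H u (2 * (k * e ^ 2) * u ^ 2) :=
    ((hasCommutator_one.sub hx).inv hu).of_eq rfl (by ring)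
  have hHv : HasCommutator φ H v (-(2 * (k * e ^ 2) * v ^ 2)) :=
    ((hasCommutator_one.add hx).inv hv).of_eq rfl (by ring)
  have hfu : HasCommutator φ f u (-(k * e * u ^ 2)) :=
    ((hasCommutator_one.sub hfx).inv hu).of_eq rfl (by ring)
  have hfv : HasCommutator φ f v (k * e * v ^ 2) :=
    ((hasCommutator_one.add hfx).inv hv).of_eq rfl (by ring)
  have hHP : HasCommutator φ H P (2 * (k * e ^ 2) ^ 2 * P ^ 3) :=
    (((hasCommutator_one.sub (hx.mul hx)).of_eq (b := 1 - (k * e ^ 2) ^ 2)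
      (b' := 2 * (-(2 * (k * e ^ 2) ^ 2))) (by ring) (by ring)).invSqrt hP hPH).of_eq rfl (by ring)
  have hfP : HasCommutator φ f P (-(k ^ 2 * e ^ 3 * P ^ 3)) :=
    (((hasCommutator_one.sub (hfx.mul hfx)).of_eq (b := 1 - (k * e ^ 2) ^ 2)
      (b' := 2 * (k ^ 2 * e ^ 3)) (by ring) (by ring)).invSqrt hP hPf).of_eq rfl (by ring)
  have hHE : HasCommutator φ H (P * e) _ := hHP.mul he
  have hHT : HasCommutator φ H (2 * u - 1) (4 * (k * e ^ 2) * u ^ 2) :=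
    ((hHu.add hHu).sub hasCommutator_one).of_eq (by ring) (by ring)
  have hHTinv : HasCommutator φ H (2 * v - 1) (-(4 * (k * e ^ 2) * v ^ 2)) :=
    ((hHv.add hHv).sub hasCommutator_one).of_eq (by ring) (by ring)
  have hfT : HasCommutator φ f (2 * u - 1) (-(2 * (k * e * u ^ 2))) :=
    ((hfu.add hfu).sub hasCommutator_one).of_eq (by ring) (by ring)
  have hfTinv : HasCommutator φ f (2 * v - 1) (2 * (k * e * v ^ 2)) :=
    ((hfv.add hfv).sub hasCommutator_one).of_eq (by ring) (by ring)
  have hfE : f * φ (P * e) = -(φ P * H) - φ (P * e) * f - φ (k ^ 2 * e ^ 4 * P ^ 3) := by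
    have h₁ : f * φ e = -H - φ e * f := by rw [← hef]; abel
    have h₂ : f * φ P = φ P * f + φ _ := hfP
    rw [map_mul, ← mul_assoc, h₂, add_mul, mul_assoc, h₁, ← map_mul, mul_assoc (φ P),
      show -(k ^ 2 * e ^ 3 * P ^ 3) * e = -(k ^ 2 * e ^ 4 * P ^ 3) by ring, map_neg]
    noncomm_ring
  have hmul : ∀ (a b : S) (r : R), φ a * (φ b * r) = φ (a * b) * r := fun a b r ↦ by
    rw [map_mul, mul_assoc]
  have huv : P ^ 2 = u * v := by
    linear_combination (-P ^ 2 * (1 + k * e ^ 2) * v) * hu - P ^ 2 * hv + u * v * hP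
  have hTF : ∀ {t a b : S}, HasCommutator φ H t a → HasCommutator φ f t b →
      φ t * F - F * φ t
        = φ (k ^ 2 * e ^ 3 * P * a - P * (1 - (k * e ^ 2) ^ 2) * b) := by
    intro t a b ha hb
    unfold HasCommutator at ha hb
    have h₁ : ∀ c, φ c * φ t = φ t * φ c := fun c ↦ by rw [← map_mul, ← map_mul, mul_comm]
    rw [hF, sub_mul, sub_mul, mul_assoc _ f, mul_assoc _ H, ha, hb, map_sub, map_mul φ _ a,
      map_mul φ _ b, mul_add, mul_add, ← mul_assoc _ (φ t), ← mul_assoc _ (φ t), h₁, h₁, h₁]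
    noncomm_ring
  refine ⟨?_, ?_, ?_, ?_, ?_, ?_, ?_⟩
  · unfold HasCommutator at hHE
    rw [hE, hHE, hT, hTinv, add_sub_cancel_left, ← map_add, ← map_mul, ← map_ofNat φ 2, ← map_mul]
    congr 1
    grind
  · have hS : HasCommutator φ H _ _ := hHT.add hHTinv
    unfold HasCommutator at hHE hS
    have hl : E * F = φ (P * e * (P * (1 - (k * e ^ 2) ^ 2))) * f
        - φ (P * e * (k ^ 2 * e ^ 3 * P ^ 3)) - φ (P * e * (k ^ 2 * e ^ 3 * P)) * H := by
      rw [hE, hF, mul_sub, mul_sub, hmul, hmul, ← map_mul]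
    have hr : F * E = φ (P * (1 - (k * e ^ 2) ^ 2)) * (f * φ (P * e))
        - φ (k ^ 2 * e ^ 3 * P ^ 3) * φ (P * e)
        - φ (k ^ 2 * e ^ 3 * P) * (H * φ (P * e)) := by
      rw [hE, hF, sub_mul, sub_mul, mul_assoc _ f, mul_assoc _ H]
    rw [hfE, hHE, mul_sub, mul_sub, mul_neg, hmul, hmul, mul_add, hmul, ← map_mul, ← map_mul,
      ← map_mul] at hr
    have hc : P * e * (P * (1 - (k * e ^ 2) ^ 2)) = P * (1 - (k * e ^ 2) ^ 2) * (P * e) := by ring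
    have hs : E * F + F * E
        = -(φ (P * (1 - (k * e ^ 2) ^ 2) * P + 2 * (k ^ 2 * e ^ 3 * P * (P * e))) * H)
        - φ (P * e * (k ^ 2 * e ^ 3 * P ^ 3)
          + P * (1 - (k * e ^ 2) ^ 2) * (k ^ 2 * e ^ 4 * P ^ 3)
          + k ^ 2 * e ^ 3 * P ^ 3 * (P * e)
          + k ^ 2 * e ^ 3 * P * (2 * (k * e ^ 2) ^ 2 * P ^ 3 * e + P * e)) := by
      rw [hl, hr, hc, mul_comm (P * e) (k ^ 2 * e ^ 3 * P),
        two_mul (k ^ 2 * e ^ 3 * P * (P * e))]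
      simp only [map_add, add_mul]
      abel
    have h₁ : 4 * (P * (1 - (k * e ^ 2) ^ 2) * P + 2 * (k ^ 2 * e ^ 3 * P * (P * e)))
        = 2 * u - 1 + (2 * v - 1) + (2 * u - 1 + (2 * v - 1)) := by
      grind
    have h₂ : 4 * (P * e * (k ^ 2 * e ^ 3 * P ^ 3)
          + P * (1 - (k * e ^ 2) ^ 2) * (k ^ 2 * e ^ 4 * P ^ 3)
          + k ^ 2 * e ^ 3 * P ^ 3 * (P * e)
          + k ^ 2 * e ^ 3 * P * (2 * (k * e ^ 2) ^ 2 * P ^ 3 * e + P * e))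
        = 4 * (k * e ^ 2) * u ^ 2 + -(4 * (k * e ^ 2) * v ^ 2) := by
      grind
    rw [hs, hT, hTinv, ← map_add, hS, mul_sub, mul_neg, show (4 : R) = φ 4 from (map_ofNat φ 4).symm,
      hmul, ← map_mul, h₁, h₂, map_add φ (2 * u - 1 + (2 * v - 1)), add_mul]
    abel
  · unfold HasCommutator at hHT
    rw [hT, hHT, add_sub_cancel_left, ← map_one φ, ← map_pow, ← map_sub]
    congr 1
    linear_combination (-4 * u) * hu
  · unfold HasCommutator at hHTinv
    rw [hTinv, hHTinv, add_sub_cancel_left, ← map_one φ, ← map_pow, ← map_sub]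
    congr 1
    linear_combination (-4 * v) * hv
  · rw [hE, hT, hTinv, ← map_ofNat φ 4, ← map_pow, ← map_sub, ← map_mul, ← map_mul]
    congr 1
    grind
  · rw [hT, hTF hHT hfT, hE, ← map_one φ, ← map_pow, ← map_add, ← map_mul, ← map_mul]
    congr 1
    grind
  · rw [hTinv, hTF hHTinv hfTinv, hE, ← map_one φ, ← map_pow, ← map_add, ← map_mul, ← map_mul,
      ← map_neg]
    congr 1
    grind

open scoped IsMulCommutative in
/-- Three pairwise commuting elements lie in the image of an injective homomorphism from a
commutative ring. -/
theorem exists_commRing_of_commute.{u} {R : Type u} [Ring R] {a b c : R}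
    (hab : Commute a b) (hac : Commute a c) (hbc : Commute b c) :
    ∃ (S : Type u) (_ : CommRing S) (φ : S →+* R) (a' b' c' : S),
      Function.Injective φ ∧ φ a' = a ∧ φ b' = b ∧ φ c' = c := by
  have h : ∀ x ∈ ({a, b, c} : Set R), ∀ y ∈ ({a, b, c} : Set R), x * y = y * x := by
    rintro x (rfl | rfl | rfl) y (rfl | rfl | rfl)
    exacts [rfl, hab, hac, hab.symm, rfl, hbc, hac.symm, hbc.symm, rfl]
  have := Algebra.isMulCommutative_adjoin ℤ h
  refine ⟨Algebra.adjoin ℤ {a, b, c}, inferInstance, (Algebra.adjoin ℤ {a, b, c}).val.toRingHom,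
    ⟨a, Algebra.subset_adjoin (by simp)⟩, ⟨b, Algebra.subset_adjoin (by simp)⟩,
    ⟨c, Algebra.subset_adjoin (by simp)⟩, Subtype.val_injective, rfl, rfl, rfl⟩

/-- In `R = A[[h]]`, with `b₊ := e²`, `Q := 1 - (h²/4)b₊²`, `E := Q^{-1/2}e`, `H := h̄`,
`T := (1 + (h/2)b₊)(1 - (h/2)b₊)⁻¹`, `T⁻¹ := (1 - (h/2)b₊)(1 + (h/2)b₊)⁻¹`, and
`F := Q^{1/2}f - (h²/4)b₊Q^{-3/2}e - (h²/4)b₊Q^{-1/2}e·h̄`, the listed Jordanian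
`U_h(osp(1|2))` relations hold (the realization in which the Cartan element `H` stays
undeformed).  Here `A` is any unital associative `ℂ`-algebra containing elements
`h̄, e, f` with the `osp(1|2)` relations; `u` and `v` are the (two-sided) inverses of
`1 - (h/2)b₊` and `1 + (h/2)b₊` in `R`. -/
theorem statement_15 (A : Type*) [Ring A] [Algebra ℂ A] (hb e f : A)
    (rel1 : hb * e - e * hb = e)
    (rel2 : hb * f - f * hb = -f)
    (rel3 : e * f + f * e = -hb)
    (u v : PowerSeries A)
    (hu : (1 - (1/2 : ℂ) • (PowerSeries.X * PowerSeries.C (R := A) (e ^ 2))) * u = 1)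
    (hu' : u * (1 - (1/2 : ℂ) • (PowerSeries.X * PowerSeries.C (R := A) (e ^ 2))) = 1)
    (hv : (1 + (1/2 : ℂ) • (PowerSeries.X * PowerSeries.C (R := A) (e ^ 2))) * v = 1)
    (hv' : v * (1 + (1/2 : ℂ) • (PowerSeries.X * PowerSeries.C (R := A) (e ^ 2))) = 1) :
    ∀ E H F T Tinv : PowerSeries A,
      E = Qpow (e ^ 2) (-(1/2)) * PowerSeries.C (R := A) e →
      H = PowerSeries.C (R := A) hb →
      T = (1 + (1/2 : ℂ) • (PowerSeries.X * PowerSeries.C (R := A) (e ^ 2))) * u →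
      Tinv = (1 - (1/2 : ℂ) • (PowerSeries.X * PowerSeries.C (R := A) (e ^ 2))) * v →
      F = Qpow (e ^ 2) (1/2) * PowerSeries.C (R := A) f -
            (1/4 : ℂ) • (PowerSeries.X ^ 2 *
              (PowerSeries.C (R := A) (e ^ 2) * Qpow (e ^ 2) (-(3/2)) * PowerSeries.C (R := A) e)) -
            (1/4 : ℂ) • (PowerSeries.X ^ 2 *
              (PowerSeries.C (R := A) (e ^ 2) * Qpow (e ^ 2) (-(1/2)) *
                PowerSeries.C (R := A) (e * hb))) →
      (H * E - E * H = (1/2 : ℂ) • ((T + Tinv) * E) ∧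
       E * F + F * E =
         -((1/4 : ℂ) • ((T + Tinv) * H)) - (1/4 : ℂ) • (H * (T + Tinv)) ∧
       H * T - T * H = T ^ 2 - 1 ∧
       H * Tinv - Tinv * H = Tinv ^ 2 - 1 ∧
       (2 : ℂ) • (PowerSeries.X * E ^ 2) = T - Tinv ∧
       T * F - F * T = (1/2 : ℂ) • (PowerSeries.X * ((T ^ 2 + 1) * E)) ∧
       Tinv * F - F * Tinv = -((1/2 : ℂ) • (PowerSeries.X * ((Tinv ^ 2 + 1) * E)))) := by
  intro E H F T Tinv hE hH hT hTinv hF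
  have hbe : e ^ 2 * e = e * e ^ 2 := by rw [← pow_succ, ← pow_succ']
  have hhe : hb * e = e * hb + e := eq_add_of_sub_eq' rel1
  have hfe : f * e = -hb - e * f := by rw [← rel3]; abel
  have hbh : Commute (e ^ 2) (e ^ 2 * hb - hb * e ^ 2) := by
    have : e ^ 2 * hb - hb * e ^ 2 = -(e ^ 2 + e ^ 2) := by
      rw [pow_two, ← mul_assoc hb, hhe, add_mul, mul_assoc e hb, hhe]
      noncomm_ring
    rw [this]
    exact ((Commute.refl _).add_right (Commute.refl _)).neg_right
  have hbf : Commute (e ^ 2) (e ^ 2 * f - f * e ^ 2) := by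
    have : e ^ 2 * f - f * e ^ 2 = e := by
      rw [pow_two, ← mul_assoc f, hfe, sub_mul, neg_mul, mul_assoc e f, hfe, hhe]
      noncomm_ring
    rw [this]
    exact hbe
  have hk : ∀ r : PowerSeries A, Commute ((1/2 : ℂ) • (PowerSeries.X : PowerSeries A)) r :=
    fun r ↦ ((PowerSeries.commute_X r).symm).smul_left _
  obtain ⟨S, _, φ, k, ε, P, hφ, hφk, hφe, hφP⟩ := exists_commRing_of_commute (hk (PowerSeries.C e))
    (hk (Qpow (e ^ 2) (-(1/2)))) (commute_Qpow_C (A := A) (b := e ^ 2) hbe (-(1/2))).symm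
  have hx : (1/2 : ℂ) • (PowerSeries.X * PowerSeries.C (R := A) (e ^ 2)) = φ (k * ε ^ 2) := by
    rw [map_mul, map_pow φ, hφk, hφe, map_pow, smul_mul_assoc]
  have hX : PowerSeries.X = (2 : ℂ) • φ k := by
    rw [hφk, smul_smul]; norm_num
  have hquarter : ∀ r : PowerSeries A, (1/4 : ℂ) • (PowerSeries.X ^ 2 * r) = φ (k ^ 2) * r := by
    intro r
    rw [map_pow, hφk, smul_pow, smul_mul_assoc]
    norm_num
  have hQ : Qpow (e ^ 2) 1 = φ (1 - (k * ε ^ 2) ^ 2) := by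
    rw [Qpow_one, hx, map_sub, map_one, map_pow]
  have hP : P ^ 2 * (1 - (k * ε ^ 2) ^ 2) = 1 := by
    apply hφ
    rw [map_mul, ← hQ, map_pow, hφP, pow_two, ← Qpow_add, ← Qpow_add, map_one, ← Qpow_zero (e ^ 2)]
    norm_num
  have hhalf : Qpow (e ^ 2) (1/2) = φ (P * (1 - (k * ε ^ 2) ^ 2)) := by
    rw [map_mul, ← hQ, hφP, ← Qpow_add]; norm_num
  have hthree : Qpow (e ^ 2) (-(3/2)) = φ (P ^ 3) := by
    rw [map_pow, hφP, pow_succ (Qpow _ _), pow_two (Qpow _ _), ← Qpow_add, ← Qpow_add]; norm_num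
  have hu₁ : u = φ (P ^ 2 * (1 + k * ε ^ 2)) := by
    have h : φ (P ^ 2 * (1 + k * ε ^ 2)) * φ (1 - k * ε ^ 2) = 1 := by
      rw [← map_mul, ← map_one φ]
      congr 1
      linear_combination hP
    rw [hx, ← map_one φ, ← map_sub] at hu
    exact (left_inv_eq_right_inv h (hu.trans (map_one φ))).symm
  have hv₁ : v = φ (P ^ 2 * (1 - k * ε ^ 2)) := by
    have h : φ (P ^ 2 * (1 - k * ε ^ 2)) * φ (1 + k * ε ^ 2) = 1 := by
      rw [← map_mul, ← map_one φ]
      congr 1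
      linear_combination hP
    rw [hx, ← map_one φ, ← map_add] at hv
    exact (left_inv_eq_right_inv h (hv.trans (map_one φ))).symm
  obtain ⟨h₁, h₂, h₃, h₄, h₅, h₆, h₇⟩ := jordanian_relations φ (k := k) (e := ε) (P := P)
    (u := P ^ 2 * (1 + k * ε ^ 2)) (v := P ^ 2 * (1 - k * ε ^ 2)) (H := H) (f := PowerSeries.C f)
    (E := E) (F := F) (T := T) (Tinv := Tinv)
    (hφk ▸ hk _) (hφk ▸ hk _) (by linear_combination hP) (by linear_combination hP) hP
    (by rw [hφe, hH, ← map_mul, ← map_mul, ← map_sub, rel1])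
    (by rw [hφe, hH, ← map_mul, ← map_mul, ← map_add, rel3, map_neg])
    (by rw [hφP, hH]; exact commute_Qpow_commutator hbh _)
    (by rw [hφP]; exact commute_Qpow_commutator hbf _)
    (by rw [hE, map_mul, hφe, hφP])
    (by
      rw [hT, hx, hu₁, ← map_one φ, ← map_add, ← map_mul]
      congr 1
      linear_combination -hP)
    (by
      rw [hTinv, hx, hv₁, ← map_one φ, ← map_sub, ← map_mul]
      congr 1
      linear_combination -hP)
    (by
      have hk₁ : k ^ 2 * ε ^ 3 * P ^ 3 = k ^ 2 * (ε ^ 2 * P ^ 3 * ε) := by ring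
      have hk₂ : k ^ 2 * ε ^ 3 * P = k ^ 2 * (ε ^ 2 * P * ε) := by ring
      rw [hF, hquarter, hquarter, hhalf, hthree, ← hφP, map_pow PowerSeries.C e 2,
        map_mul PowerSeries.C e hb, ← hφe, ← hH, hk₁, hk₂]
      simp only [map_mul, map_pow, mul_assoc])
  have eq_smul : ∀ {c : ℂ} {x y : PowerSeries A}, c ≠ 0 → algebraMap ℂ _ c * x = y →
      x = (1 / c) • y := by
    rintro c x _ hc rfl
    rw [← Algebra.smul_def, smul_smul, one_div_mul_cancel hc, one_smul]
  refine ⟨eq_smul two_ne_zero (by rw [map_ofNat, h₁]), ?_, h₃, h₄, ?_, ?_, ?_⟩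
  · rw [eq_smul (c := 4) (x := E * F + F * E) (by norm_num) (by rw [map_ofNat, h₂]), smul_sub, smul_neg]
  · rw [← h₅, hX, smul_mul_assoc, smul_smul, Algebra.smul_def, map_mul, map_ofNat]
    norm_num
  · rw [h₆, hX, smul_mul_assoc, smul_smul]; norm_num
  · rw [h₇, hX, smul_mul_assoc, smul_smul]; norm_num
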